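/- arXiv:2604.22141 — 2 statements merged into one kernel-verified Lean document; each statement's English description precedes it below -/
import Mathlib

section
/- Let 0 ≤ k ≤ n be integers and let λ = (λ_1 ≥ λ_2 ≥ … ≥ λ_k) be a partition with λ_k ≥ n − k. Then in F = ℚ(z_1,…,z_n) one has s_{(λ_1−n+k, λ_2−n+k, …, λ_k−n+k)}(z_1,…,z_n) = Σ over all k-element subsets S ⊆ {1,…,n} of s_λ(z_S) / [∏_{i∈S} ∏_{j∉S} (z_i − z_j)], where on the left the partition (λ_1−n+k,…,λ_k−n+k) is padded with n−k zeros to length n. -/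
open scoped BigOperators

noncomputable section

/-- `F N` is the field `ℚ(z_1, …, z_N)` of rational functions in `N` variables. -/
abbrev F (N : ℕ) := FractionRing (MvPolynomial (Fin N) ℚ)

/-- The variable `z_a` viewed inside `F N`. -/
noncomputable def z {N : ℕ} (a : Fin N) : F N :=
  algebraMap (MvPolynomial (Fin N) ℚ) (F N) (MvPolynomial.X a)

/-- `z_A^p := ∏_{a ∈ A} z_a^p`. -/
noncomputable def zpowProd {N : ℕ} (A : Finset (Fin N)) (p : ℤ) : F N :=
  ∏ a ∈ A, z a ^ p

/-- `1 − z_A/z_B := ∏_{a∈A} ∏_{b∈B} (1 − z_a/z_b)`. -/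
noncomputable def oneSub {N : ℕ} (A B : Finset (Fin N)) : F N :=
  ∏ a ∈ A, ∏ b ∈ B, (1 - z a / z b)

/-- `z_A − z_B := ∏_{a∈A} ∏_{b∈B} (z_a − z_b)`. -/
noncomputable def zsub {N : ℕ} (A B : Finset (Fin N)) : F N :=
  ∏ a ∈ A, ∏ b ∈ B, (z a - z b)

/-- Read an exponent sequence off a list, padding with `0`. -/
def padded (L : List ℤ) : ℕ → ℤ := fun t => L.getD t 0

/-- The Schur polynomial (bialternant form) associated with the index set
`A ⊆ {1,…,N}` (with its increasing enumeration) and the exponent sequence `lam`. -/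
noncomputable def schur {N : ℕ} (A : Finset (Fin N)) (lam : ℕ → ℤ) : F N :=
  Matrix.det (Matrix.of fun i j : Fin A.card =>
      z ((A.orderIsoOfFin rfl i : Fin N)) ^ (lam j + (A.card : ℤ) - 1 - (j : ℤ)))
    / Matrix.det (Matrix.of fun i j : Fin A.card =>
      z ((A.orderIsoOfFin rfl i : Fin N)) ^ ((A.card : ℤ) - 1 - (j : ℤ)))


/-- Laplace expansion along the set `T` of columns: the determinant is the sum, over the sets `S`
of rows of the same size, of the determinants of the block parts of the matrix. -/
theorem Matrix.det_eq_sum_powersetCard_det_block {ι R : Type*} [Fintype ι] [DecidableEq ι]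
    [CommRing R] (M : Matrix ι ι R) (T : Finset ι) :
    M.det = ∑ S ∈ Finset.powersetCard T.card Finset.univ,
      (Matrix.of fun i j => if i ∈ S ↔ j ∈ T then M i j else 0).det := by
  simp_rw [Matrix.det_apply]
  rw [Finset.sum_comm]
  refine Finset.sum_congr rfl fun σ _ => ?_
  rw [← Finset.smul_sum]
  congr 1
  rw [Finset.sum_eq_single (T.map σ.toEmbedding)]
  · refine Finset.prod_congr rfl fun i _ => ?_
    simp
  · intro S _ hS
    have : ∃ i, ¬ (σ i ∈ S ↔ i ∈ T) := by
      by_contra! h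
      apply hS
      ext a
      obtain ⟨i, rfl⟩ := σ.surjective a
      simp [h i]
    obtain ⟨i, hi⟩ := this
    exact Finset.prod_eq_zero (Finset.mem_univ i) (by simp [hi])
  · simp [Finset.mem_powersetCard]

theorem Matrix.det_projVandermonde_one_add {R : Type*} [CommRing R] {k m : ℕ}
    (y : Fin (k + m) → R) :
    (projVandermonde 1 y).det
      = (projVandermonde 1 fun i => y (Fin.castAdd m i)).det
        * (projVandermonde 1 fun i => y (Fin.natAdd k i)).det
        * ∏ i : Fin k, ∏ j : Fin m, (y (Fin.castAdd m i) - y (Fin.natAdd k j)) := by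
  have key : ∀ (l : ℕ) (w : Fin l → R), (projVandermonde 1 w).det
      = ∏ i, ∏ j, if i < j then w i - w j else 1 := by
    intro l w
    rw [det_projVandermonde]
    refine Finset.prod_congr rfl fun i _ => ?_
    rw [← Finset.prod_filter]
    simp [Finset.filter_lt_eq_Ioi]
  have hlt (i : Fin k) (j : Fin m) : (i : ℕ) < k + j := by omega
  simp only [key, Fin.prod_univ_add, hlt, (hlt _ _).not_gt, if_true, if_false,
    Finset.prod_mul_distrib, Finset.prod_const_one, Fin.lt_def, Fin.val_castAdd,
    Fin.val_natAdd, add_lt_add_iff_left]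
  ring

theorem Matrix.det_projVandermonde_one_ne_zero {K : Type*} [Field K] {m : ℕ}
    {y : Fin m → K} (hy : Function.Injective y) : (projVandermonde 1 y).det ≠ 0 := by
  rw [det_projVandermonde]
  refine Finset.prod_ne_zero_iff.2 fun i _ => Finset.prod_ne_zero_iff.2 fun j hj => ?_
  simpa [sub_eq_zero] using hy.ne (Finset.mem_Ioi.1 hj).ne

open Matrix in
theorem det_block_div_det_projVandermonde {K : Type*} [Field K] {k m : ℕ}
    {x : Fin (k + m) → K} (hx : Function.Injective x) (g : Fin k → K → K)
    (S : Finset (Fin (k + m))) (hS : S.card = k) :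
    (Matrix.of fun i j => if i ∈ S ↔ j ∈ Finset.univ.map (Fin.castAddEmb m) then
        Fin.addCases (motive := fun _ => K) (fun j => g j (x i))
          (fun j : Fin m => x i ^ (j.rev : ℕ)) j else 0).det
        / (projVandermonde 1 x).det
      = (Matrix.of fun i j => g j (x (S.orderEmbOfFin hS i))).det
          / (projVandermonde 1 fun i => x (S.orderEmbOfFin hS i)).det
          / ∏ a ∈ S, ∏ b ∈ Sᶜ, (x a - x b) := by
  have hSc : Sᶜ.card = m := by
    rw [Finset.card_compl, Fintype.card_fin, hS]; omega
  let e : Fin k ⊕ Fin m ≃ Fin (k + m) := finSumEquivOfFinset hS hSc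
  let σ : Equiv.Perm (Fin (k + m)) := finSumFinEquiv.symm.trans e
  have hl (i : Fin k) : σ (Fin.castAdd m i) = S.orderEmbOfFin hS i := by simp [σ, e]
  have hr (i : Fin m) : σ (Fin.natAdd k i) = Sᶜ.orderEmbOfFin hSc i := by simp [σ, e]
  have hV : (projVandermonde 1 fun i => x (σ i)) = (projVandermonde 1 x).submatrix σ id := by
    ext; simp [projVandermonde_apply]
  have hVdet := congrArg Matrix.det hV
  rw [Matrix.det_permute, Matrix.det_projVandermonde_one_add] at hVdet
  simp only [hl, hr] at hVdet
  have hprod : ∏ a ∈ S, ∏ b ∈ Sᶜ, (x a - x b)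
      = ∏ i : Fin k, ∏ j : Fin m, (x (S.orderEmbOfFin hS i) - x (Sᶜ.orderEmbOfFin hSc j)) := by
    have hreindex {l : ℕ} (A : Finset (Fin (k + m))) (hA : A.card = l) (f : Fin (k + m) → K) :
        ∏ a ∈ A, f a = ∏ i, f (A.orderEmbOfFin hA i) := by
      conv_lhs => rw [← Finset.map_orderEmbOfFin_univ A hA, Finset.prod_map]
      rfl
    simp only [hreindex S hS, hreindex Sᶜ hSc]
  set N : Matrix (Fin (k + m)) (Fin (k + m)) K := Matrix.of fun i j =>
    if i ∈ S ↔ j ∈ Finset.univ.map (Fin.castAddEmb m) then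
        Fin.addCases (motive := fun _ => K) (fun j => g j (x i))
          (fun j : Fin m => x i ^ (j.rev : ℕ)) j else 0 with hN
  have hNdet : (N.submatrix σ id).det
      = (Matrix.of fun i j => g j (x (S.orderEmbOfFin hS i))).det
        * (projVandermonde 1 fun i => x (Sᶜ.orderEmbOfFin hSc i)).det := by
    rw [← Matrix.det_fromBlocks_zero₂₁ _ 0, ← Matrix.det_submatrix_equiv_self finSumFinEquiv]
    congr 1
    have hmemr (i : Fin m) : Sᶜ.orderEmbOfFin hSc i ∉ S :=
      Finset.mem_compl.1 (Finset.orderEmbOfFin_mem _ hSc i)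
    have hne (a : Fin k) (j : Fin m) : Fin.castAdd m a ≠ Fin.natAdd k j := by
      intro h
      have := congrArg Fin.val h
      simp only [Fin.val_castAdd, Fin.val_natAdd] at this
      omega
    ext (i | i) (j | j) <;>
      simp [hN, hl, hr, hmemr, hne, projVandermonde_apply]
  rw [Matrix.det_permute] at hNdet
  have hs : ((Equiv.Perm.sign σ : ℤ) : K) ≠ 0 := by
    rcases Int.units_eq_one_or (Equiv.Perm.sign σ) with h | h <;> simp [h]
  rw [← mul_div_mul_left _ _ hs, hNdet, ← hVdet, hprod]
  have h2 : (projVandermonde 1 fun i => x (Sᶜ.orderEmbOfFin hSc i)).det ≠ 0 :=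
    Matrix.det_projVandermonde_one_ne_zero (hx.comp (Sᶜ.orderEmbOfFin hSc).injective)
  rw [div_div, mul_right_comm, mul_div_mul_right _ _ h2]

open Matrix in
/-- The Gustafson–Milne identity with arbitrary functions `g j` in place of powers. -/
theorem det_div_det_projVandermonde_eq_sum {K : Type*} [Field K] {k m : ℕ}
    {x : Fin (k + m) → K} (hx : Function.Injective x) (g : Fin k → K → K)
    (f : Finset (Fin (k + m)) → K)
    (hf : ∀ S (hS : S.card = k), f S = (Matrix.of fun i j => g j (x (S.orderEmbOfFin hS i))).det
      / (projVandermonde 1 fun i => x (S.orderEmbOfFin hS i)).det) :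
    (Matrix.of fun i j => Fin.addCases (motive := fun _ => K) (fun j => g j (x i))
        (fun j : Fin m => x i ^ (j.rev : ℕ)) j).det / (projVandermonde 1 x).det
      = ∑ S ∈ Finset.powersetCard k Finset.univ, f S / ∏ a ∈ S, ∏ b ∈ Sᶜ, (x a - x b) := by
  rw [Matrix.det_eq_sum_powersetCard_det_block _ (Finset.univ.map (Fin.castAddEmb m)),
    Finset.sum_div, Finset.card_map, Finset.card_univ, Fintype.card_fin]
  refine Finset.sum_congr rfl fun S hS => ?_
  have hS' := (Finset.mem_powersetCard.1 hS).2
  rw [hf S hS', ← det_block_div_det_projVandermonde hx g S hS']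
  rfl

theorem z_injective (N : ℕ) : Function.Injective (z : Fin N → F N) :=
  (IsFractionRing.injective (MvPolynomial (Fin N) ℚ) (F N)).comp
    (MvPolynomial.X_injective (R := ℚ))

theorem schur_eq_div_det_projVandermonde {N m : ℕ} (A : Finset (Fin N)) (hA : A.card = m)
    (lam : ℕ → ℤ) :
    schur A lam = (Matrix.of fun i j : Fin m =>
        z (A.orderEmbOfFin hA i) ^ (lam j + (m : ℤ) - 1 - (j : ℤ))).det
      / (Matrix.projVandermonde 1 fun i => z (A.orderEmbOfFin hA i)).det := by
  subst hA
  rw [schur]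
  congr 2
  ext i j
  rw [Matrix.of_apply, Matrix.projVandermonde_apply, Pi.one_apply, one_pow, one_mul,
    Fin.val_rev, Finset.coe_orderIsoOfFin_apply, ← zpow_natCast]
  congr 1
  omega

open Classical in
/-- the Gustafson–Milne identity for Schur polynomials. -/
theorem statement5 (n k : ℕ) (hk : k ≤ n)
    (lam : Fin k → ℕ) (hanti : ∀ j j' : Fin k, j ≤ j' → lam j' ≤ lam j)
    (hbound : ∀ j, n ≤ lam j + k) :
    schur (Finset.univ : Finset (Fin n))
        (padded (List.ofFn fun j : Fin k => (lam j : ℤ) - n + k))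
      = ∑ S ∈ Finset.powersetCard k (Finset.univ : Finset (Fin n)),
          schur S (padded (List.ofFn fun j : Fin k => (lam j : ℤ))) / zsub S Sᶜ := by
  obtain ⟨m, rfl⟩ := Nat.exists_eq_add_of_le hk
  have hid : ∀ i, (Finset.univ : Finset (Fin (k + m))).orderEmbOfFin (Finset.card_fin _) i = i :=
    fun i => (congrFun (Finset.orderEmbOfFin_unique (Finset.card_fin _)
      (fun i => Finset.mem_univ i) strictMono_id) i).symm
  have hpad (L : Fin k → ℤ) (j : Fin k) : padded (List.ofFn L) j = L j := by
    simp [padded]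
  have hpad0 (L : Fin k → ℤ) (j : ℕ) : padded (List.ofFn L) (k + j) = 0 := by
    simp [padded]
  simp only [zsub]
  rw [← det_div_det_projVandermonde_eq_sum (z_injective (k + m))
      (fun j t => t ^ ((lam j : ℤ) + k - 1 - (j : ℤ)))]
  · rw [schur_eq_div_det_projVandermonde _ (Finset.card_fin _)]
    simp only [hid]
    congr 2
    ext i j
    refine Fin.addCases (fun j => ?_) (fun j => ?_) j
    · simp only [Matrix.of_apply, Fin.addCases_left, Fin.val_castAdd, hpad]
      congr 1
      push_cast
      ring
    · simp only [Matrix.of_apply, Fin.addCases_right, Fin.val_natAdd, hpad0, Fin.val_rev]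
      rw [← zpow_natCast]
      congr 1
      omega
  · intro S hS
    rw [schur_eq_div_det_projVandermonde S hS]
    simp only [hpad]

end
end

section
/- Let m ≥ 2 and n > i_2 > i_3 > … > i_m ≥ 0 be integers, and let (B_1, B_2, …, B_m) be an ordered decomposition of {1,…,N}. Then in F = ℚ(z_1,…,z_N) one has s_{((n−m+1)^{|B_1|}, (i_2−m+2)^{|B_2|}, …, i_m^{|B_m|})}(z_1,…,z_N) = Σ over all ordered decompositions (C, C′) of {1,…,N} with |C| = |B_1| of s_{((i_2−m+2)^{|B_2|}, (i_3−m+3)^{|B_3|}, …, i_m^{|B_m|})}(z_{C′}) · z_C^{ n+1−m+|C′|} / (z_C − z_{C′}). -/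
open scoped BigOperators

noncomputable section

theorem z_ne_zero {N : ℕ} (a : Fin N) : z a ≠ 0 := by
  simp [z, MvPolynomial.X_ne_zero]

theorem schur_eq_orderEmbOfFin {N k : ℕ} (A : Finset (Fin N)) (hA : A.card = k) (lam : ℕ → ℤ) :
    schur A lam =
      Matrix.det (Matrix.of fun i j : Fin k =>
          z (A.orderEmbOfFin hA i) ^ (lam j + (k : ℤ) - 1 - (j : ℤ))) /
        Matrix.det (Matrix.of fun i j : Fin k =>
          z (A.orderEmbOfFin hA i) ^ ((k : ℤ) - 1 - (j : ℤ))) := by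
  subst hA
  rfl

theorem det_pow_rev_eq_prod {K : Type*} [Field K] {n : ℕ} (w : Fin n → K) :
    Matrix.det (Matrix.of fun i j : Fin n => w i ^ ((n : ℤ) - 1 - (j : ℤ))) =
      ∏ i, ∏ j, if i < j then w i - w j else 1 := by
  have h : (Matrix.of fun i j : Fin n => w i ^ ((n : ℤ) - 1 - (j : ℤ))) =
      Matrix.projVandermonde 1 w := by
    ext i j
    rw [Matrix.projVandermonde_apply, Matrix.of_apply, ← zpow_natCast (w i)]
    simp only [Pi.one_apply, one_pow, one_mul, Fin.val_rev]
    congr 1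
    have := j.isLt
    omega
  rw [h, Matrix.det_projVandermonde]
  refine Finset.prod_congr rfl fun i _ => ?_
  rw [← Finset.prod_filter]
  refine Finset.prod_congr (by ext; simp) fun j _ => by simp

/-- Factorization of a Vandermonde determinant along a splitting of the variables. -/
theorem det_pow_rev_add {K : Type*} [Field K] {k l : ℕ} (w : Fin (k + l) → K) :
    Matrix.det (Matrix.of fun i j : Fin (k + l) => w i ^ (((k + l : ℕ) : ℤ) - 1 - (j : ℤ))) =
      Matrix.det (Matrix.of fun i j : Fin k =>
          w (Fin.castAdd l i) ^ ((k : ℤ) - 1 - (j : ℤ))) *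
        Matrix.det (Matrix.of fun i j : Fin l =>
          w (Fin.natAdd k i) ^ ((l : ℤ) - 1 - (j : ℤ))) *
        ∏ i : Fin k, ∏ j : Fin l, (w (Fin.castAdd l i) - w (Fin.natAdd k j)) := by
  have h₁ (i j : Fin k) : Fin.castAdd l i < Fin.castAdd l j ↔ i < j := Iff.rfl
  have h₂ (i j : Fin l) : Fin.natAdd k i < Fin.natAdd k j ↔ i < j := by simp
  have h₃ (i : Fin k) (j : Fin l) : Fin.castAdd l i < Fin.natAdd k j := by
    simp only [Fin.lt_def, Fin.val_castAdd, Fin.val_natAdd]; omega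
  have h₄ (i : Fin k) (j : Fin l) : ¬ Fin.natAdd k j < Fin.castAdd l i := (h₃ i j).le.not_gt
  rw [det_pow_rev_eq_prod, det_pow_rev_eq_prod fun i => w (Fin.castAdd l i),
    det_pow_rev_eq_prod fun i => w (Fin.natAdd k i)]
  simp only [Fin.prod_univ_add, h₁, h₂, h₃, h₄, if_true, if_false, Finset.prod_mul_distrib,
    Finset.prod_const_one]
  ring

open Classical in
/-- Laplace expansion of a determinant along its first `k` columns. -/
theorem det_eq_sum_det_ite {R : Type*} [CommRing R] {k l : ℕ}
    (A : Matrix (Fin (k + l)) (Fin (k + l)) R) :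
    A.det = ∑ P ∈ Finset.univ.filter (fun P : Finset (Fin (k + l)) × Finset (Fin (k + l)) =>
          P.1.card = k ∧ Disjoint P.1 P.2 ∧ P.1 ∪ P.2 = Finset.univ),
        (Matrix.of fun i j : Fin (k + l) => if (i ∈ P.1 ↔ (j : ℕ) < k) then A i j else 0).det := by
  simp only [Matrix.det_apply]
  rw [Finset.sum_comm]
  refine Finset.sum_congr rfl fun σ _ => ?_
  rw [← Finset.smul_sum]
  congr 1
  set C : Finset (Fin (k + l)) :=
    (Finset.univ.filter fun j : Fin (k + l) => (j : ℕ) < k).map σ.toEmbedding with hC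
  have mem_C (j) : σ j ∈ C ↔ (j : ℕ) < k := by simp [hC]
  rw [Finset.sum_eq_single (C, Cᶜ)]
  · simp [mem_C]
  · rintro ⟨C₁, C₂⟩ hP hne
    obtain ⟨-, hd, hu⟩ := (Finset.mem_filter.mp hP).2
    dsimp only at hd hu
    have h₂ : C₂ = C₁ᶜ :=
      (IsCompl.of_eq (Finset.disjoint_iff_inter_eq_empty.mp hd) hu).symm.eq_compl
    have h₁ : C₁ ≠ C := by
      rintro rfl
      exact hne (by rw [h₂])
    obtain ⟨j, hj⟩ : ∃ j, ¬ (σ j ∈ C₁ ↔ (j : ℕ) < k) := by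
      by_contra! h
      refine h₁ (Finset.ext fun a => ?_)
      obtain ⟨j, rfl⟩ := σ.surjective a
      rw [h, mem_C]
    exact Finset.prod_eq_zero (Finset.mem_univ j) (by simp [hj])
  · intro h
    refine absurd (Finset.mem_filter.mpr ⟨Finset.mem_univ _, ?_, disjoint_compl_right, by simp⟩) h
    simp [hC, Fin.card_filter_val_lt]

theorem det_div_det_eq_submatrix {K α β : Type*} [Field K] [Fintype α] [DecidableEq α]
    [Fintype β] [DecidableEq β] (e e₀ : β ≃ α) (A V : Matrix α α K) :
    A.det / V.det = (A.submatrix e e₀).det / (V.submatrix e e₀).det := by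
  have h (M : Matrix α α K) :
      (M.submatrix e e₀).det = Equiv.Perm.sign (e₀.symm.trans e) * M.det := by
    rw [← Matrix.det_permute, ← Matrix.det_submatrix_equiv_self e₀]
    congr 1
    ext i j
    simp
  rw [h, h, mul_div_mul_left]
  exact ((Equiv.Perm.sign (e₀.symm.trans e)).isUnit.map (Int.castRingHom K)).ne_zero

theorem prod_orderEmbOfFin {N k : ℕ} {M : Type*} [CommMonoid M] (A : Finset (Fin N))
    (hA : A.card = k) (f : Fin N → M) : ∏ i, f (A.orderEmbOfFin hA i) = ∏ a ∈ A, f a := by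
  simpa using (Finset.prod_map Finset.univ (A.orderEmbOfFin hA).toEmbedding f).symm

open Classical in
/-- A Schur polynomial whose sequence starts with `k` copies of `c`, as a sum over the ways of
choosing the `k` variables that carry these entries. -/
theorem schur_univ_eq_sum {N k l : ℕ} (hN : k + l = N) (c : ℤ) (lam mu : ℕ → ℤ)
    (hlam : ∀ t < k, lam t = c) (hmu : ∀ t, lam (k + t) = mu t) :
    schur (Finset.univ : Finset (Fin N)) lam =
      ∑ P ∈ Finset.univ.filter (fun P : Finset (Fin N) × Finset (Fin N) =>
          P.1.card = k ∧ Disjoint P.1 P.2 ∧ P.1 ∪ P.2 = Finset.univ),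
        schur P.2 mu * zpowProd P.1 (c + P.2.card) / zsub P.1 P.2 := by
  subst hN
  have huniv : (Finset.univ : Finset (Fin (k + l))).card = k + l := by simp
  have hid : ⇑((Finset.univ : Finset (Fin (k + l))).orderEmbOfFin huniv) = id :=
    (Finset.orderEmbOfFin_unique huniv (fun _ => Finset.mem_univ _) strictMono_id).symm
  rw [schur_eq_orderEmbOfFin _ huniv, det_eq_sum_det_ite, Finset.sum_div]
  refine Finset.sum_congr rfl ?_
  rintro ⟨C, C'⟩ hP
  obtain ⟨hC, hd, hu⟩ := (Finset.mem_filter.mp hP).2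
  dsimp only at hC hd hu ⊢
  obtain rfl : C' = Cᶜ := (IsCompl.of_eq (Finset.disjoint_iff_inter_eq_empty.mp hd) hu).symm.eq_compl
  have hC' : Cᶜ.card = l := by simp [Finset.card_compl, hC]
  set e := finSumEquivOfFinset hC hC' with he
  have hV : (Matrix.of fun i j : Fin (k + l) =>
        z ((Finset.univ : Finset (Fin (k + l))).orderEmbOfFin huniv i) ^
          (((k + l : ℕ) : ℤ) - 1 - (j : ℤ))).submatrix e finSumFinEquiv =
      (Matrix.of fun i j : Fin (k + l) => z (e (finSumFinEquiv.symm i)) ^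
          (((k + l : ℕ) : ℤ) - 1 - (j : ℤ))).submatrix finSumFinEquiv finSumFinEquiv := by
    ext i j
    simp [hid]
  have hA : (Matrix.of fun i j : Fin (k + l) => if (i ∈ C ↔ (j : ℕ) < k) then
        (Matrix.of fun i j : Fin (k + l) =>
          z ((Finset.univ : Finset (Fin (k + l))).orderEmbOfFin huniv i) ^
          (lam j + ((k + l : ℕ) : ℤ) - 1 - (j : ℤ))) i j else 0).submatrix e finSumFinEquiv =
      Matrix.fromBlocks
        (Matrix.of fun i j : Fin k => z (C.orderEmbOfFin hC i) ^ (c + l) *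
          (Matrix.of fun i j : Fin k =>
            z (C.orderEmbOfFin hC i) ^ ((k : ℤ) - 1 - (j : ℤ))) i j) 0 0
        (Matrix.of fun i j : Fin l =>
          z (Cᶜ.orderEmbOfFin hC' i) ^ (mu j + (l : ℤ) - 1 - (j : ℤ))) := by
    ext i j
    rcases i with i | i <;> rcases j with j | j
    · simp only [he, hid, id, Matrix.submatrix_apply, Matrix.of_apply, finSumEquivOfFinset_inl,
        finSumFinEquiv_apply_left, Matrix.fromBlocks_apply₁₁, Fin.val_castAdd, j.isLt,
        Finset.orderEmbOfFin_mem, if_true, hlam]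
      rw [← zpow_add₀ (z_ne_zero _)]
      congr 1
      push_cast
      ring
    · simp [he]
    · have := Finset.mem_compl.mp (Cᶜ.orderEmbOfFin_mem hC' i)
      simp [he, this]
    · have := Finset.mem_compl.mp (Cᶜ.orderEmbOfFin_mem hC' i)
      simp only [he, hid, id, Matrix.submatrix_apply, Matrix.of_apply, finSumEquivOfFinset_inr,
        finSumFinEquiv_apply_right, Matrix.fromBlocks_apply₂₂, Fin.val_natAdd, this,
        Nat.not_lt.mpr (Nat.le_add_right k j), if_true, hmu]
      congr 1
      push_cast
      ring
  have hVC : Matrix.det (Matrix.of fun i j : Fin k =>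
      z (C.orderEmbOfFin hC i) ^ ((k : ℤ) - 1 - (j : ℤ))) ≠ 0 := by
    rw [det_pow_rev_eq_prod fun i => z (C.orderEmbOfFin hC i)]
    refine Finset.prod_ne_zero_iff.mpr fun i _ => Finset.prod_ne_zero_iff.mpr fun j _ => ?_
    split_ifs with hij
    · refine sub_ne_zero.mpr fun h => hij.ne ?_
      exact (C.orderEmbOfFin hC).injective
        (MvPolynomial.X_injective (IsFractionRing.injective _ _ h))
    · exact one_ne_zero
  have hsub : ∏ i : Fin k, ∏ j : Fin l,
      (z (C.orderEmbOfFin hC i) - z (Cᶜ.orderEmbOfFin hC' j)) = zsub C Cᶜ := by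
    rw [zsub, ← prod_orderEmbOfFin C hC]
    exact Finset.prod_congr rfl fun i _ => prod_orderEmbOfFin Cᶜ hC' fun b => _ - z b
  have hpow : ∏ i : Fin k, z (C.orderEmbOfFin hC i) ^ (c + l) = zpowProd C (c + l) :=
    prod_orderEmbOfFin C hC fun a => z a ^ (c + l)
  rw [det_div_det_eq_submatrix e finSumFinEquiv, hV, hA, Matrix.det_submatrix_equiv_self,
    det_pow_rev_add fun i => z (e (finSumFinEquiv.symm i)), Matrix.det_fromBlocks_zero₂₁,
    Matrix.det_mul_column, hpow, schur_eq_orderEmbOfFin Cᶜ hC', hC']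
  simp only [he, finSumFinEquiv_symm_apply_castAdd, finSumFinEquiv_symm_apply_natAdd,
    finSumEquivOfFinset_inl, finSumEquivOfFinset_inr, hsub]
  rw [div_mul_eq_mul_div, div_div, mul_assoc, mul_comm (zpowProd _ _), mul_assoc, mul_assoc,
    mul_div_mul_left _ _ hVC]

open Classical in
/-- the unified FNR-type identity with the first block frozen at `n`.
Here `i j` denotes `i_{j+2}` for `j : Fin (m-1)`, so that `n > i_2 > ⋯ > i_m ≥ 0`. -/
theorem statement6 (N n m : ℕ) (hm : 2 ≤ m)
    (i : Fin (m - 1) → ℕ) (hanti : StrictAnti i) (hn : ∀ j, i j < n)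
    (B : Fin m → Finset (Fin N))
    (hdisj : ∀ j k, j ≠ k → Disjoint (B j) (B k))
    (hcover : Finset.univ.biUnion B = Finset.univ) :
    schur (Finset.univ : Finset (Fin N))
        (padded (List.replicate (B ⟨0, by omega⟩).card ((n : ℤ) - m + 1) ++
          (List.ofFn fun j : Fin (m - 1) =>
            List.replicate (B ⟨(j : ℕ) + 1, by have := j.isLt; omega⟩).card
              ((i j : ℤ) - m + 2 + (j : ℤ))).flatten))
      = ∑ P ∈ Finset.univ.filter (fun P : Finset (Fin N) × Finset (Fin N) =>
            P.1.card = (B ⟨0, by omega⟩).card ∧ Disjoint P.1 P.2 ∧ P.1 ∪ P.2 = Finset.univ),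
          schur P.2
              (padded (List.ofFn fun j : Fin (m - 1) =>
                List.replicate (B ⟨(j : ℕ) + 1, by have := j.isLt; omega⟩).card
                  ((i j : ℤ) - m + 2 + (j : ℤ))).flatten) *
            zpowProd P.1 ((n : ℤ) + 1 - m + P.2.card) / zsub P.1 P.2 := by
  set k := (B ⟨0, by omega⟩).card with hk
  have hkN : k ≤ N := by simpa [hk] using Finset.card_le_univ (B ⟨0, by omega⟩)
  rw [schur_univ_eq_sum (Nat.add_sub_cancel' hkN) ((n : ℤ) - m + 1)]
  · refine Finset.sum_congr rfl fun P _ => ?_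
    rw [show (n : ℤ) - m + 1 + P.2.card = (n : ℤ) + 1 - m + P.2.card by ring]
  · intro t ht
    rw [padded, List.getD_append _ _ _ _ (by simpa using ht), List.getD_replicate _ ht]
  · intro t
    rw [padded, List.getD_append_right _ _ _ _ (by simp)]
    simp [padded]

end
end
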